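/- Let q be a prime. There is no family of q-product blocks B_0, ..., B_{q-1} over ZMod q in which every block has exactly 1 element and the union of all blocks has exactly 2 elements (no (q,1,2)-PB exists), and there is no such family in which every block has exactly 2 elements and the union of all blocks has exactly 3 elements (no (q,2,3)-PB exists). -/

import Mathlib

/-- In a family of product blocks over a field, the index sets of two distinct points have total
size at most the number of indices: a translate of one is disjoint from the other. -/
theorem card_filter_mem_add_card_filter_mem_le {F : Type*} [Field F] [Fintype F] [DecidableEq F]
    {B : F → Finset F}
    (h : ∀ r s : F, ∀ a ∈ B r, ∀ b ∈ B s, (b - a) * (s - r) ≠ 1) {x y : F} (hxy : x ≠ y) :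
    (Finset.univ.filter fun r => x ∈ B r).card + (Finset.univ.filter fun r => y ∈ B r).card
      ≤ Fintype.card F := by
  have hd : y - x ≠ 0 := sub_ne_zero.2 hxy.symm
  rw [← Finset.card_map (addRightEmbedding (y - x)⁻¹), ← Finset.card_union_of_disjoint]
  · exact Finset.card_le_univ _
  · rw [Finset.disjoint_left]
    intro s hs hys
    simp only [Finset.mem_map, Finset.mem_filter, Finset.mem_univ, true_and] at hs hys
    obtain ⟨r, hr, rfl⟩ := hs
    refine h r _ x hr y hys ?_
    simp [hd]

/-- A subset of `ZMod q`, `q` prime, which is stable under a nonzero translation and nonempty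
is everything. -/
theorem forall_of_add_of_ne_zero {q : ℕ} [Fact q.Prime] {P : ZMod q → Prop} {d r : ZMod q}
    (hd : d ≠ 0) (hP : ∀ s, P s → P (s + d)) (hr : P r) (s : ZMod q) : P s := by
  have key : ∀ n : ℕ, P (r + n * d) := by
    intro n
    induction n with
    | zero => simpa using hr
    | succ k ih =>
      have := hP _ ih
      rwa [add_assoc, ← add_one_mul, ← Nat.cast_succ] at this
  have := key ((s - r) / d).val
  rwa [ZMod.natCast_zmod_val, div_mul_cancel₀ _ hd, add_sub_cancel] at this

/-- For a prime `q` there is no `(q,1,2)`-PB and no `(q,2,3)`-PB. -/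
theorem no_q12_and_no_q23_product_blocks (q : ℕ) [Fact q.Prime] :
    (¬ ∃ B : ZMod q → Finset (ZMod q),
      (∀ r s : ZMod q, ∀ a ∈ B r, ∀ b ∈ B s, (b - a) * (s - r) ≠ 1) ∧
      (∀ s : ZMod q, (B s).card = 1) ∧
      (Finset.univ.biUnion B).card = 2) ∧
    (¬ ∃ B : ZMod q → Finset (ZMod q),
      (∀ r s : ZMod q, ∀ a ∈ B r, ∀ b ∈ B s, (b - a) * (s - r) ≠ 1) ∧
      (∀ s : ZMod q, (B s).card = 2) ∧
      (Finset.univ.biUnion B).card = 3) := by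
  constructor
  · rintro ⟨B, h, h1, hU⟩
    obtain ⟨x, y, hxy, hU⟩ := Finset.card_eq_two.1 hU
    have hmem : ∀ a, (∃ r, a ∈ B r) ↔ a = x ∨ a = y := fun a => by
      simpa using Finset.ext_iff.1 hU a
    obtain ⟨r, hr⟩ := (hmem x).2 (Or.inl rfl)
    obtain ⟨s, hs⟩ := (hmem y).2 (Or.inr rfl)
    have hd : y - x ≠ 0 := sub_ne_zero.2 hxy.symm
    have hx : ∀ s, x ∈ B s := by
      refine forall_of_add_of_ne_zero (inv_ne_zero hd) (fun t ht => ?_) hr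
      obtain ⟨a, ha⟩ := Finset.card_pos.1 ((h1 (t + (y - x)⁻¹)).symm ▸ one_pos)
      rcases (hmem a).1 ⟨_, ha⟩ with rfl | rfl
      · exact ha
      · exact absurd (by simp [hd]) (h t _ x ht a ha)
    exact hxy (Finset.card_le_one.1 (h1 s).le x (hx s) y hs)
  · rintro ⟨B, h, h2, hU⟩
    obtain ⟨x, y, z, hxy, hxz, hyz, hU⟩ := Finset.card_eq_three.1 hU
    have hxy' := card_filter_mem_add_card_filter_mem_le h hxy
    have hxz' := card_filter_mem_add_card_filter_mem_le h hxz
    have hyz' := card_filter_mem_add_card_filter_mem_le h hyz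
    have hcount := Finset.sum_card_bipartiteAbove_eq_sum_card_bipartiteBelow
      (s := ({x, y, z} : Finset (ZMod q))) (t := Finset.univ) (fun a r => a ∈ B r)
    have hB : ∀ r, (Finset.bipartiteBelow (fun a r => a ∈ B r) {x, y, z} r).card = 2 := by
      intro r
      rw [← h2 r, Finset.bipartiteBelow, Finset.filter_mem_eq_inter, ← hU,
        Finset.inter_eq_right.2 (Finset.subset_biUnion_of_mem B (Finset.mem_univ r))]
    simp only [hB, Finset.sum_const, Finset.card_univ, smul_eq_mul] at hcount
    rw [Finset.sum_insert (by simp [hxy, hxz]), Finset.sum_insert (by simp [hyz]),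
      Finset.sum_singleton] at hcount
    simp only [Finset.bipartiteAbove] at hcount
    have hq : 0 < Fintype.card (ZMod q) := Fintype.card_pos
    lia
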